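/- Let a, b, n, m, ℓ be nonnegative integers with a + m = b + n = ℓ. Then the sum over all π ∈ S_ℓ of p^{imaj(π_{>a})} q^{maj(π^{>b})} equals the sum over j = 0, 1, ..., a, with k = n - a + j, of j! · C(a,j) · C(b,j) · [b-j]_p! · [a-j]_q! · [m choose k]_p · [n choose k]_q · A_k(p,q). -/

import Mathlib

open Finset

namespace QT

/-- The major index of a permutation of `Fin n` (sum of descents,
with positions written `1,...,n-1` as in one-line notation). -/
def maj {n : ℕ} (π : Equiv.Perm (Fin n)) : ℕ :=
  ∑ i ∈ Finset.range n,
    if h : i + 1 < n then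
      (if π ⟨i + 1, h⟩ < π ⟨i, by omega⟩ then i + 1 else 0)
    else 0

/-- `imaj π = maj π⁻¹`. -/
def imaj {n : ℕ} (π : Equiv.Perm (Fin n)) : ℕ := maj π⁻¹

/-- The permutation of `Fin k` order-isomorphic to the word `v 0, v 1, ..., v (k-1)`. -/
noncomputable def standardize {n k : ℕ} (v : Fin k → Fin n) (hv : Function.Injective v) :
    Equiv.Perm (Fin k) :=
  Equiv.ofBijective
    (fun i => (Finset.orderIsoOfFin (Finset.image v Finset.univ)
        (by rw [Finset.card_image_of_injective _ hv, Finset.card_univ, Fintype.card_fin])).symm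
        ⟨v i, Finset.mem_image_of_mem v (Finset.mem_univ i)⟩)
    (Finite.injective_iff_bijective.mp (fun i j hij => by
      have h2 := (Finset.orderIsoOfFin _ _).symm.injective hij
      exact hv (congrArg Subtype.val h2)))

/-- `π^{≤k}` : the permutation of `Fin k` order-isomorphic to the first `k` letters of `π`. -/
noncomputable def pInit {n : ℕ} (π : Equiv.Perm (Fin n)) (k : ℕ) (hk : k ≤ n) :
    Equiv.Perm (Fin k) :=
  standardize (fun i => π (Fin.castLE hk i))
    (fun i j h => Fin.castLE_injective hk (π.injective h))

/-- `π^{>k}` : the permutation of `Fin (n-k)` order-isomorphic to the last `n - k` letters of `π`. -/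
noncomputable def pTail {n : ℕ} (π : Equiv.Perm (Fin n)) (k : ℕ) :
    Equiv.Perm (Fin (n - k)) :=
  standardize (fun i => π ⟨k + (i : ℕ), by have := i.isLt; omega⟩)
    (fun i j h => by
      have h2 : k + (i : ℕ) = k + (j : ℕ) := congrArg Fin.val (π.injective h)
      exact Fin.ext (by omega))

/-- `π_{≤k}` : the permutation of `Fin k` order-isomorphic to the subword of `π`
consisting of the `k` smallest values.  (Equivalently `((π⁻¹)^{≤k})⁻¹`.) -/
noncomputable def vLow {n : ℕ} (π : Equiv.Perm (Fin n)) (k : ℕ) (hk : k ≤ n) :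
    Equiv.Perm (Fin k) := (pInit π⁻¹ k hk)⁻¹

/-- `π_{>k}` : the permutation of `Fin (n-k)` order-isomorphic to the subword of `π`
consisting of the values `> k`.  (Equivalently `((π⁻¹)^{>k})⁻¹`.) -/
noncomputable def vHigh {n : ℕ} (π : Equiv.Perm (Fin n)) (k : ℕ) :
    Equiv.Perm (Fin (n - k)) := (pTail π⁻¹ k)⁻¹

/-- The set `I_n` of involutions in `S_n`. -/
def involutions (n : ℕ) : Finset (Equiv.Perm (Fin n)) :=
  Finset.univ.filter fun π => π * π = 1

-- `I_n(σ) = {π ∈ I_n : π_{≤m} = σ}`.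
open scoped Classical in
noncomputable def involutionsC (n : ℕ) {m : ℕ} (σ : Equiv.Perm (Fin m)) :
    Finset (Equiv.Perm (Fin n)) :=
  (involutions n).filter fun π => ∃ h : m ≤ n, vLow π m h = σ

-- `S_n(σ,τ) = {π ∈ S_n : π_{≤a} = σ, π^{≤b} = τ}`.
open scoped Classical in
noncomputable def permsC (n : ℕ) {a b : ℕ} (σ : Equiv.Perm (Fin a)) (τ : Equiv.Perm (Fin b)) :
    Finset (Equiv.Perm (Fin n)) :=
  Finset.univ.filter fun π => ∃ (ha : a ≤ n) (hb : b ≤ n), vLow π a ha = σ ∧ pInit π b hb = τ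

-- The j-set `J(σ) = {j : σ^{≤j} is an involution}`.
open scoped Classical in
noncomputable def jSet {m : ℕ} (σ : Equiv.Perm (Fin m)) : Finset ℕ :=
  (Finset.range (m + 1)).filter fun j => ∃ h : j ≤ m, pInit σ j h * pInit σ j h = 1

-- The j₂-set `J(σ,τ) = {j : σ^{≤j} = τ_{≤j}}`.
open scoped Classical in
noncomputable def j2Set {a b : ℕ} (σ : Equiv.Perm (Fin a)) (τ : Equiv.Perm (Fin b)) :
    Finset ℕ :=
  (Finset.range (min a b + 1)).filter fun j =>
    ∃ (ha : j ≤ a) (hb : j ≤ b), pInit σ j ha = vLow τ j hb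

/-- A set of nonnegative integers is a j₂-set if it is `J(σ,τ)` for some pair of
permutations. -/
def IsJ2Set (S : Finset ℕ) : Prop :=
  ∃ (a b : ℕ) (σ : Equiv.Perm (Fin a)) (τ : Equiv.Perm (Fin b)), S = j2Set σ τ

-- The number of j₂-sets with largest element `n`.
open scoped Classical in
noncomputable def j2count (n : ℕ) : ℕ :=
  ((Finset.range (n + 1)).powerset.filter
    fun S => IsJ2Set S ∧ n ∈ S ∧ ∀ x ∈ S, x ≤ n).card

/-- `[n]_q = 1 + q + ⋯ + q^{n-1}`. -/
def qInt (q : ℝ) (n : ℕ) : ℝ := ∑ i ∈ Finset.range n, q ^ i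

/-- The q-factorial `[n]_q! = ∏_{i=1}^n (1 + q + ⋯ + q^{i-1})`. -/
def qFact (q : ℝ) (n : ℕ) : ℝ := ∏ i ∈ Finset.range n, qInt q (i + 1)

/-- The Gaussian binomial coefficient `[n choose k]_q = [n]_q!/([k]_q! [n-k]_q!)`,
defined via the q-Pascal recursion. -/
def qBinom (q : ℝ) : ℕ → ℕ → ℝ
  | _, 0 => 1
  | 0, _ + 1 => 0
  | n + 1, k + 1 => qBinom q n k + q ^ (k + 1) * qBinom q n (k + 1)

/-- `t_n(q) = Σ_{π ∈ I_n} q^{maj π}`. -/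
noncomputable def tq (q : ℝ) (n : ℕ) : ℝ := ∑ π ∈ involutions n, q ^ maj π

/-- `A_n(p,q) = Σ_{π ∈ S_n} p^{imaj π} q^{maj π}`. -/
noncomputable def Apq (p q : ℝ) (n : ℕ) : ℝ :=
  ∑ π : Equiv.Perm (Fin n), p ^ imaj π * q ^ maj π


/-- The major index of the word `f 0, ..., f (k - 1)`. -/
def wordMaj (f : ℕ → ℕ) (k : ℕ) : ℕ :=
  ∑ i ∈ range (k - 1), if f (i + 1) < f i then i + 1 else 0

/-- The word obtained from `f` by inserting the letter `0` in position `x`. -/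
def insertZero (x : ℕ) (f : ℕ → ℕ) : ℕ → ℕ :=
  fun t => if t < x then f t else if t = x then 0 else f (t - 1)

lemma wordMaj_congr {f g : ℕ → ℕ} {k : ℕ}
    (h : ∀ i, i + 1 < k → (f (i + 1) < f i ↔ g (i + 1) < g i)) :
    wordMaj f k = wordMaj g k := by
  refine sum_congr rfl fun i hi => ?_
  rw [mem_range] at hi
  simp only [h i (by omega)]

lemma wordMaj_succ (f : ℕ → ℕ) (k : ℕ) :
    wordMaj f (k + 1) = wordMaj f k + if 0 < k ∧ f k < f (k - 1) then k else 0 := by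
  cases k with
  | zero => simp [wordMaj]
  | succ k => simp [wordMaj, sum_range_succ]

lemma wordMaj_insertZero_last {f : ℕ → ℕ} {k : ℕ} (hf : ∀ i < k, 0 < f i) :
    wordMaj (insertZero k f) (k + 1) = wordMaj f k + k := by
  rw [wordMaj_succ]
  congr 1
  · refine wordMaj_congr fun i hi => ?_
    simp [insertZero, hi, show i < k by omega]
  · rcases Nat.eq_zero_or_pos k with rfl | hk
    · simp
    · simp [insertZero, hk, hf (k - 1) (by omega)]

lemma qInt_succ (q : ℝ) (n : ℕ) : qInt q (n + 1) = qInt q n + q ^ n := sum_range_succ _ _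

lemma qInt_succ' (q : ℝ) (n : ℕ) : qInt q (n + 1) = q * qInt q n + 1 := by
  simp [qInt, sum_range_succ', mul_sum, pow_succ']

lemma qInt_add (q : ℝ) (m n : ℕ) : qInt q (m + n) = qInt q m + q ^ m * qInt q n := by
  simp [qInt, sum_range_add, mul_sum, pow_add]

/-- Inserting a new smallest letter into a word in all possible ways multiplies
its `q`-weight by a `q`-integer. -/
lemma sum_pow_wordMaj_insertZero (q : ℝ) (f : ℕ → ℕ) (k : ℕ) (hf : ∀ i < k, 0 < f i) :
    ∑ x ∈ range (k + 1), q ^ wordMaj (insertZero x f) (k + 1) =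
      qInt q (k + 1) * q ^ wordMaj f k := by
  induction k with
  | zero => simp [wordMaj, qInt]
  | succ k ih =>
    have ih := ih fun i hi => hf i (by omega)
    have hlast := wordMaj_insertZero_last (f := f) (k := k) fun i hi => hf i (by omega)
    have hmid : wordMaj (insertZero k f) (k + 1 + 1) = wordMaj f k + k := by
      rw [wordMaj_succ, hlast]
      simp [insertZero]
    rw [sum_range_succ, hlast, qInt_succ] at ih
    rw [sum_range_succ, sum_range_succ, wordMaj_insertZero_last hf, hmid]
    have hsum : ∑ x ∈ range k, q ^ wordMaj (insertZero x f) (k + 1 + 1) =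
        (∑ x ∈ range k, q ^ wordMaj (insertZero x f) (k + 1)) *
          q ^ (if 0 < k ∧ f k < f (k - 1) then k + 1 else 0) := by
      rw [sum_mul]
      refine sum_congr rfl fun x hx => ?_
      rw [mem_range] at hx
      rw [wordMaj_succ, ← pow_add]
      simp [insertZero, show ¬ k + 1 < x by omega, show ¬ k < x by omega,
        show k + 1 ≠ x by omega, show k ≠ x by omega, show 0 < k by omega]
    have hs : ∑ x ∈ range k, q ^ wordMaj (insertZero x f) (k + 1) =
        qInt q k * q ^ wordMaj f k := by
      rw [pow_add] at ih
      linarith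
    rw [hsum, hs, wordMaj_succ f k]
    split_ifs
    · rw [qInt_succ', qInt_succ]
      simp only [pow_add, pow_one]
      ring
    · rw [qInt_succ, qInt_succ]
      simp only [pow_add, pow_one, pow_zero, add_zero]
      ring

/-- The one-line notation of a permutation, extended by zero. -/
def word {ℓ : ℕ} (π : Equiv.Perm (Fin ℓ)) (t : ℕ) : ℕ :=
  if h : t < ℓ then (π ⟨t, h⟩ : ℕ) else 0

/-- The major index of the word of `π` from position `b` on. -/
def tailMaj {ℓ : ℕ} (π : Equiv.Perm (Fin ℓ)) (b : ℕ) : ℕ :=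
  wordMaj (fun t => word π (b + t)) (ℓ - b)

lemma standardize_lt_iff {n k : ℕ} (v : Fin k → Fin n) (hv : Function.Injective v)
    (i j : Fin k) : standardize v hv i < standardize v hv j ↔ v i < v j := by
  simp [standardize]

lemma pTail_lt_iff {ℓ : ℕ} (π : Equiv.Perm (Fin ℓ)) (b : ℕ) (i j : Fin (ℓ - b)) :
    pTail π b i < pTail π b j ↔ π ⟨b + i, by omega⟩ < π ⟨b + j, by omega⟩ :=
  standardize_lt_iff _ _ _ _

lemma sum_range_pred (F : ℕ → ℕ) (k : ℕ) :
    ∑ i ∈ range (k - 1), F i = ∑ i ∈ range k, if i + 1 < k then F i else 0 := by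
  cases k with
  | zero => simp
  | succ k =>
    rw [sum_range_succ, if_neg (by omega), add_zero]
    refine sum_congr rfl fun i hi => ?_
    rw [mem_range] at hi
    rw [if_pos (by omega)]

lemma maj_pTail {ℓ : ℕ} (π : Equiv.Perm (Fin ℓ)) (b : ℕ) : maj (pTail π b) = tailMaj π b := by
  unfold maj tailMaj wordMaj
  rw [sum_range_pred]
  refine sum_congr rfl fun i _ => ?_
  by_cases hi : i + 1 < ℓ - b
  · rw [dif_pos hi, if_pos hi]
    simp only [pTail_lt_iff, word, show b + (i + 1) < ℓ by omega, show b + i < ℓ by omega,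
      dif_pos, Fin.val_fin_lt]
  · rw [dif_neg hi, if_neg hi]

lemma maj_eq_tailMaj {ℓ : ℕ} (π : Equiv.Perm (Fin ℓ)) : maj π = tailMaj π 0 := by
  rw [← maj_pTail]
  unfold maj
  refine sum_congr rfl fun i _ => ?_
  simp only [pTail_lt_iff, Nat.zero_add]
  rfl

/-- The permutation whose smallest value is in position `x` and whose other values
are ordered as in `σ`. -/
def insertMin {ℓ : ℕ} (x : Fin (ℓ + 1)) (σ : Equiv.Perm (Fin ℓ)) : Equiv.Perm (Fin (ℓ + 1)) :=
  (finSuccEquiv' x).trans (σ.optionCongr.trans (finSuccEquiv' 0).symm)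

@[simp] lemma insertMin_self {ℓ : ℕ} (x : Fin (ℓ + 1)) (σ : Equiv.Perm (Fin ℓ)) :
    insertMin x σ x = 0 := by
  simp [insertMin]

@[simp] lemma insertMin_succAbove {ℓ : ℕ} (x : Fin (ℓ + 1)) (σ : Equiv.Perm (Fin ℓ))
    (i : Fin ℓ) : insertMin x σ (x.succAbove i) = (σ i).succ := by
  simp [insertMin]

lemma insertMin_inv_succ {ℓ : ℕ} (x : Fin (ℓ + 1)) (σ : Equiv.Perm (Fin ℓ)) (v : Fin ℓ) :
    (insertMin x σ)⁻¹ v.succ = x.succAbove (σ⁻¹ v) := by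
  rw [Equiv.Perm.inv_eq_iff_eq]
  simp

lemma insertMin_bijective (ℓ : ℕ) :
    Function.Bijective fun y : Fin (ℓ + 1) × Equiv.Perm (Fin ℓ) => insertMin y.1 y.2 := by
  rw [Fintype.bijective_iff_injective_and_card]
  constructor
  · rintro ⟨x, σ⟩ ⟨y, τ⟩ h
    simp only at h
    have hxy : x = y := by
      apply (insertMin y τ).injective
      rw [insertMin_self, ← h, insertMin_self]
    subst hxy
    refine Prod.ext rfl (Equiv.ext fun i => ?_)
    have := congrArg (fun π => π (x.succAbove i)) h
    simpa using this
  · simp [Fintype.card_perm, Nat.factorial_succ]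

lemma word_insertMin {ℓ : ℕ} (x : Fin (ℓ + 1)) (σ : Equiv.Perm (Fin ℓ)) {t : ℕ}
    (ht : t < ℓ + 1) :
    word (insertMin x σ) t = insertZero x (fun s => word σ s + 1) t := by
  rw [word, dif_pos ht]
  unfold insertZero
  rcases lt_trichotomy t (x : ℕ) with h | h | h
  · have hx := x.isLt
    have : (⟨t, ht⟩ : Fin (ℓ + 1)) = x.succAbove ⟨t, by omega⟩ := by
      rw [Fin.succAbove_of_castSucc_lt _ _ (by simpa [Fin.lt_def] using h)]
      rfl
    rw [this, insertMin_succAbove]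
    simp [h, word, show t < ℓ by omega]
  · have : (⟨t, ht⟩ : Fin (ℓ + 1)) = x := Fin.ext h
    rw [this, insertMin_self]
    simp [h]
  · have : (⟨t, ht⟩ : Fin (ℓ + 1)) = x.succAbove ⟨t - 1, by omega⟩ := by
      rw [Fin.succAbove_of_le_castSucc _ _ (by simp [Fin.le_def]; omega)]
      ext
      simp
      omega
    rw [this, insertMin_succAbove]
    simp [show ¬ t < (x : ℕ) by omega, show t ≠ x by omega, word, show t - 1 < ℓ by omega]

lemma tailMaj_insertMin_inv {ℓ : ℕ} (x : Fin (ℓ + 1)) (σ : Equiv.Perm (Fin ℓ)) (a : ℕ) :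
    tailMaj (insertMin x σ)⁻¹ (a + 1) = tailMaj σ⁻¹ a := by
  unfold tailMaj
  rw [Nat.add_sub_add_right]
  have key : ∀ (t : ℕ) (ht : a + t < ℓ),
      word (insertMin x σ)⁻¹ (a + 1 + t) = x.succAbove (σ⁻¹ ⟨a + t, ht⟩) := by
    intro t ht
    rw [word, dif_pos (by omega), ← insertMin_inv_succ]
    congr 2
    ext
    simp
    omega
  refine wordMaj_congr fun i hi => ?_
  rw [key _ (by omega), key _ (by omega), word, word, dif_pos (by omega), dif_pos (by omega),
    Fin.val_fin_lt, Fin.val_fin_lt, Fin.succAbove_lt_succAbove_iff]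

lemma tailMaj_insertMin_of_lt {ℓ : ℕ} (x : Fin (ℓ + 1)) (σ : Equiv.Perm (Fin ℓ)) {b : ℕ}
    (h : (x : ℕ) < b) : tailMaj (insertMin x σ) b = tailMaj σ (b - 1) := by
  unfold tailMaj
  rw [show ℓ - (b - 1) = ℓ + 1 - b by omega]
  refine wordMaj_congr fun i hi => ?_
  rw [word_insertMin _ _ (by omega), word_insertMin _ _ (by omega)]
  simp only [insertZero, show ¬ b + (i + 1) < (x : ℕ) by omega, show ¬ b + i < (x : ℕ) by omega,
    show b + (i + 1) ≠ (x : ℕ) by omega, show b + i ≠ (x : ℕ) by omega, if_false]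
  rw [show b + (i + 1) - 1 = b - 1 + (i + 1) by omega, show b + i - 1 = b - 1 + i by omega]
  omega

lemma tailMaj_insertMin_of_le {ℓ : ℕ} (x : Fin (ℓ + 1)) (σ : Equiv.Perm (Fin ℓ)) {b : ℕ}
    (h : b ≤ (x : ℕ)) : tailMaj (insertMin x σ) b =
      wordMaj (insertZero (x - b) fun t => word σ (b + t) + 1) (ℓ - b + 1) := by
  have hx := x.isLt
  unfold tailMaj
  rw [show ℓ + 1 - b = ℓ - b + 1 by omega]
  have key : ∀ t, b + t < ℓ + 1 → word (insertMin x σ) (b + t) =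
      insertZero (x - b) (fun t => word σ (b + t) + 1) t := by
    intro t ht
    rw [word_insertMin _ _ ht]
    unfold insertZero
    rcases lt_trichotomy (b + t) (x : ℕ) with h' | h' | h'
    · rw [if_pos h', if_pos (by omega)]
    · rw [if_neg (by omega), if_pos h', if_neg (by omega), if_pos (by omega)]
    · rw [if_neg (by omega), if_neg (by omega), if_neg (by omega), if_neg (by omega),
        Nat.add_sub_assoc (by omega)]
  refine wordMaj_congr fun i hi => ?_
  rw [key _ (by omega), key _ (by omega)]

lemma sum_pow_tailMaj_insertMin {ℓ : ℕ} (σ : Equiv.Perm (Fin ℓ)) {b : ℕ} (hb : b ≤ ℓ + 1)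
    (q : ℝ) : ∑ x : Fin (ℓ + 1), q ^ tailMaj (insertMin x σ) b =
      b * q ^ tailMaj σ (b - 1) + qInt q (ℓ + 1 - b) * q ^ tailMaj σ b := by
  have h : ∑ x : Fin (ℓ + 1), q ^ tailMaj (insertMin x σ) b =
      ∑ x ∈ range (ℓ + 1), if x < b then q ^ tailMaj σ (b - 1) else
        q ^ wordMaj (insertZero (x - b) fun t => word σ (b + t) + 1) (ℓ - b + 1) := by
    rw [← Fin.sum_univ_eq_sum_range (fun x => if x < b then q ^ tailMaj σ (b - 1) else
        q ^ wordMaj (insertZero (x - b) fun t => word σ (b + t) + 1) (ℓ - b + 1))]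
    refine sum_congr rfl fun x _ => ?_
    split_ifs with hx
    · rw [tailMaj_insertMin_of_lt _ _ hx]
    · rw [tailMaj_insertMin_of_le _ _ (by omega)]
  obtain ⟨n, hn⟩ := Nat.exists_eq_add_of_le hb
  rw [h, hn, sum_range_add, Nat.add_sub_cancel_left]
  congr 1
  · rw [sum_congr rfl fun x hx => if_pos (mem_range.1 hx)]
    simp
  · cases n with
    | zero => simp [qInt]
    | succ n =>
      have hm : ℓ - b = n := by omega
      have hw : tailMaj σ b = wordMaj (fun t => word σ (b + t) + 1) n := by
        rw [tailMaj, hm]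
        exact wordMaj_congr (by simp)
      rw [hw, hm, ← sum_pow_wordMaj_insertZero _ _ _ (by simp)]
      simp

/-- The generating function of the tail major indices of `π⁻¹` and `π`. -/
noncomputable def tailGen (p q : ℝ) (ℓ a b : ℕ) : ℝ :=
  ∑ π : Equiv.Perm (Fin ℓ), p ^ tailMaj π⁻¹ a * q ^ tailMaj π b

lemma tailGen_symm (p q : ℝ) (ℓ a b : ℕ) : tailGen p q ℓ a b = tailGen q p ℓ b a := by
  unfold tailGen
  rw [← Equiv.sum_comp (Equiv.inv (Equiv.Perm (Fin ℓ)))]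
  simp [mul_comm]

lemma tailGen_zero_zero (p q : ℝ) (ℓ : ℕ) : tailGen p q ℓ 0 0 = Apq p q ℓ := by
  simp [tailGen, Apq, imaj, maj_eq_tailMaj]

lemma tailGen_succ (p q : ℝ) {ℓ b : ℕ} (a : ℕ) (hb : b ≤ ℓ + 1) :
    tailGen p q (ℓ + 1) (a + 1) b =
      b * tailGen p q ℓ a (b - 1) + qInt q (ℓ + 1 - b) * tailGen p q ℓ a b := by
  unfold tailGen
  rw [← (insertMin_bijective ℓ).sum_comp, Fintype.sum_prod_type, sum_comm, mul_sum, mul_sum,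
    ← sum_add_distrib]
  refine sum_congr rfl fun σ _ => ?_
  simp only [tailMaj_insertMin_inv]
  rw [← mul_sum, sum_pow_tailMaj_insertMin _ hb]
  ring

/-- The product `[k + 1]_q ⋯ [k + r]_q`. -/
def qAsc (q : ℝ) (k r : ℕ) : ℝ := ∏ i ∈ range r, qInt q (k + i + 1)

lemma qAsc_succ (q : ℝ) (k r : ℕ) : qAsc q k (r + 1) = qAsc q k r * qInt q (k + r + 1) :=
  prod_range_succ _ _

lemma qAsc_succ' (q : ℝ) (k r : ℕ) :
    qAsc q k (r + 1) = qInt q (k + 1) * qAsc q (k + 1) r := by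
  unfold qAsc
  rw [prod_range_succ', mul_comm]
  simp [add_comm, add_left_comm]

lemma qBinom_eq_zero_of_lt (q : ℝ) {n k : ℕ} (h : n < k) : qBinom q n k = 0 := by
  induction n generalizing k with
  | zero =>
    obtain ⟨k, rfl⟩ := Nat.exists_eq_succ_of_ne_zero (by omega : k ≠ 0)
    rw [qBinom]
  | succ n ih =>
    obtain ⟨k, rfl⟩ := Nat.exists_eq_succ_of_ne_zero (by omega : k ≠ 0)
    rw [qBinom, ih (by omega), ih (by omega)]
    simp

lemma qFact_mul_qBinom (q : ℝ) (k r : ℕ) : qFact q r * qBinom q (k + r) k = qAsc q k r := by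
  induction k generalizing r with
  | zero => simp [qBinom, qFact, qAsc]
  | succ k ihk =>
    induction r with
    | zero =>
      have h := ihk 0
      rw [add_zero] at h ⊢
      rw [qBinom, qBinom_eq_zero_of_lt q (Nat.lt_succ_self k)]
      simpa [qAsc] using h
    | succ r ihr =>
      have h := ihk (r + 1)
      have hf : qFact q (r + 1) = qFact q r * qInt q (r + 1) := prod_range_succ _ _
      rw [show k + 1 + (r + 1) = k + (r + 1) + 1 by omega, qBinom, mul_add, h, hf,
        show k + (r + 1) = k + 1 + r by omega, qAsc_succ q k, qAsc_succ q (k + 1),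
        show k + 1 + r + 1 = k + 1 + (r + 1) by omega, qInt_add q (k + 1) (r + 1)]
      have hk := qAsc_succ q k r
      rw [qAsc_succ'] at hk
      linear_combination q ^ (k + 1) * qInt q (r + 1) * ihr - hk

/-- The contribution to `tailGen` of the permutations with `j` points in the corner formed by
the first `b` positions and the `a` smallest values. -/
noncomputable def cornerTerm (p q : ℝ) (a b n j : ℕ) : ℝ :=
  if a ≤ n + j then
    (j.factorial : ℝ) * (a.choose j : ℝ) * (b.choose j : ℝ) * qAsc p (n + j - a) (b - j) *
      qAsc q (n + j - a) (a - j) * Apq p q (n + j - a)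
  else 0

lemma cornerTerm_eq_zero_of_lt (p q : ℝ) {a j : ℕ} (b n : ℕ) (h : a < j) :
    cornerTerm p q a b n j = 0 := by
  simp [cornerTerm, Nat.choose_eq_zero_of_lt h]

lemma qInt_mul_qAsc (q : ℝ) {a n j : ℕ} (hj : j ≤ a) (h : a ≤ n + j) :
    qInt q (n + 1) * qAsc q (n + j - a) (a - j) = qAsc q (n + j - a) (a - j + 1) := by
  rw [qAsc_succ, show n + j - a + (a - j) + 1 = n + 1 by omega, mul_comm]

lemma cornerTerm_succ_zero (p q : ℝ) (a b n : ℕ) :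
    cornerTerm p q (a + 1) b n 0 = qInt q n * cornerTerm p q a b (n - 1) 0 := by
  cases n with
  | zero => simp [cornerTerm, qInt]
  | succ n =>
    unfold cornerTerm
    by_cases h : a ≤ n + 0
    · have hq := qInt_mul_qAsc q (Nat.zero_le a) h
      rw [if_pos (by omega), if_pos (by simpa using h),
        show n + 1 + 0 - (a + 1) = n + 0 - a by omega, show n + 1 - 1 = n from rfl,
        show a + 1 - 0 = a - 0 + 1 by omega, ← hq]
      simp
      ring
    · rw [if_neg (by omega), if_neg (by simpa using h), mul_zero]

lemma cornerTerm_succ_succ (p q : ℝ) (a b n j : ℕ) :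
    cornerTerm p q (a + 1) (b + 1) n (j + 1) =
      (b + 1 : ℕ) * cornerTerm p q a b n j +
        qInt q n * cornerTerm p q a (b + 1) (n - 1) (j + 1) := by
  have hc : ((b + 1 : ℕ) : ℝ) * b.choose j = (b + 1).choose (j + 1) * ((j + 1 : ℕ) : ℝ) := by
    exact_mod_cast Nat.add_one_mul_choose_eq b j
  have hfirst : a ≤ n + j → (b + 1 : ℕ) * cornerTerm p q a b n j =
      ((j + 1).factorial : ℝ) * a.choose j * (b + 1).choose (j + 1) * qAsc p (n + j - a) (b - j) *
        qAsc q (n + j - a) (a - j) * Apq p q (n + j - a) := by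
    intro h
    rw [cornerTerm, if_pos h, Nat.factorial_succ, Nat.cast_mul]
    linear_combination (j.factorial : ℝ) * a.choose j * qAsc p (n + j - a) (b - j) *
        qAsc q (n + j - a) (a - j) * Apq p q (n + j - a) * hc
  by_cases h : a ≤ n + j
  · have hsecond : qInt q n * cornerTerm p q a (b + 1) (n - 1) (j + 1) =
        ((j + 1).factorial : ℝ) * a.choose (j + 1) * (b + 1).choose (j + 1) *
          qAsc p (n + j - a) (b - j) * qAsc q (n + j - a) (a - j) * Apq p q (n + j - a) := by
      rcases lt_or_ge a (j + 1) with hj | hj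
      · rw [cornerTerm_eq_zero_of_lt _ _ _ _ hj, Nat.choose_eq_zero_of_lt hj]
        simp
      · obtain ⟨n, rfl⟩ := Nat.exists_eq_succ_of_ne_zero (by omega : n ≠ 0)
        have hq := qInt_mul_qAsc q hj (show a ≤ n + (j + 1) by omega)
        rw [show a - (j + 1) + 1 = a - j by omega] at hq
        rw [Nat.succ_eq_add_one, Nat.add_sub_cancel, cornerTerm, if_pos (by omega),
          show n + 1 + j - a = n + (j + 1) - a by omega, ← hq,
          show b + 1 - (j + 1) = b - j by omega]
        ring
    rw [hfirst h, hsecond, cornerTerm, if_pos (by omega), Nat.choose_succ_succ a j,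
      show n + (j + 1) - (a + 1) = n + j - a by omega, show b + 1 - (j + 1) = b - j by omega,
      show a + 1 - (j + 1) = a - j by omega]
    push_cast
    ring
  · rw [cornerTerm, cornerTerm, if_neg (by omega), if_neg h]
    cases n with
    | zero => simp [qInt]
    | succ n =>
      rw [cornerTerm, if_neg (by omega)]
      simp

lemma sum_cornerTerm_succ (p q : ℝ) (a b n : ℕ) :
    ∑ j ∈ range (a + 2), cornerTerm p q (a + 1) b n j =
      b * ∑ j ∈ range (a + 1), cornerTerm p q a (b - 1) n j +
        qInt q n * ∑ j ∈ range (a + 1), cornerTerm p q a b (n - 1) j := by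
  have h : ∑ j ∈ range (a + 1), cornerTerm p q a b (n - 1) j =
      ∑ j ∈ range (a + 2), cornerTerm p q a b (n - 1) j := by
    rw [sum_range_succ _ (a + 1), cornerTerm_eq_zero_of_lt _ _ _ _ (Nat.lt_succ_self a), add_zero]
  rw [h, sum_range_succ', sum_range_succ' _ (a + 1), cornerTerm_succ_zero, mul_add, ← add_assoc,
    mul_sum, mul_sum, ← sum_add_distrib]
  congr 1
  refine sum_congr rfl fun j _ => ?_
  cases b with
  | zero => simp [cornerTerm]
  | succ b => exact cornerTerm_succ_succ p q a b n j

lemma tailGen_right_zero (p q : ℝ) (b n : ℕ) :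
    tailGen p q (b + n) b 0 = qAsc q n b * Apq p q n := by
  induction b with
  | zero => simp [tailGen_zero_zero, qAsc]
  | succ b ih =>
    rw [show b + 1 + n = b + n + 1 by omega, tailGen_succ _ _ _ (Nat.zero_le _), ih, qAsc_succ,
      show b + n + 1 - 0 = n + b + 1 by omega]
    simp
    ring

lemma Apq_symm (p q : ℝ) (n : ℕ) : Apq p q n = Apq q p n := by
  rw [← tailGen_zero_zero, tailGen_symm, tailGen_zero_zero]

lemma tailGen_eq_sum_cornerTerm (p q : ℝ) {a b n : ℕ} (h : a ≤ b + n) :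
    tailGen p q (b + n) a b = ∑ j ∈ range (a + 1), cornerTerm p q a b n j := by
  induction a generalizing b n with
  | zero =>
    rw [tailGen_symm, tailGen_right_zero, Apq_symm]
    simp [cornerTerm, qAsc]
  | succ a ih =>
    obtain ⟨ℓ, hℓ⟩ := Nat.exists_eq_add_of_le' (show 1 ≤ b + n by omega)
    rw [hℓ, tailGen_succ _ _ _ (by omega), sum_cornerTerm_succ, show ℓ + 1 - b = n by omega]
    congr 1
    · cases b with
      | zero => simp
      | succ b => rw [Nat.add_sub_cancel, ← ih (by omega), show ℓ = b + n by omega]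
    · cases n with
      | zero => simp [qInt]
      | succ n => rw [Nat.add_sub_cancel, ← ih (by omega), show ℓ = b + n by omega]

/-- For `a + m = b + n = ℓ`,
`Σ_{π ∈ S_ℓ} p^{imaj(π_{>a})} q^{maj(π^{>b})}
  = Σ_{j=0}^{a} j! C(a,j) C(b,j) [b-j]_p! [a-j]_q! [m choose k]_p [n choose k]_q A_k(p,q)`
with `k = n - a + j` (terms with `k < 0` vanish). -/
theorem stmt2 (a b n m ℓ : ℕ) (h1 : a + m = ℓ) (h2 : b + n = ℓ) (p q : ℝ) :
    ∑ π : Equiv.Perm (Fin ℓ), p ^ imaj (vHigh π a) * q ^ maj (pTail π b) =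
      ∑ j ∈ Finset.range (a + 1),
        if a ≤ n + j then
          (j.factorial : ℝ) * (a.choose j : ℝ) * (b.choose j : ℝ) * qFact p (b - j) *
            qFact q (a - j) * qBinom p m (n + j - a) * qBinom q n (n + j - a) *
            Apq p q (n + j - a)
        else 0 := by
  have hL : ∀ π : Equiv.Perm (Fin ℓ), p ^ imaj (vHigh π a) * q ^ maj (pTail π b) =
      p ^ tailMaj π⁻¹ a * q ^ tailMaj π b := fun π => by
    rw [imaj, vHigh, inv_inv, maj_pTail, maj_pTail]
  rw [sum_congr rfl fun π _ => hL π]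
  subst h2
  refine (tailGen_eq_sum_cornerTerm p q (by omega)).trans (sum_congr rfl fun j hj => ?_)
  rw [mem_range] at hj
  unfold cornerTerm
  split_ifs with h
  · rcases lt_or_ge b j with hbj | hbj
    · simp [Nat.choose_eq_zero_of_lt hbj]
    · rw [← qFact_mul_qBinom, ← qFact_mul_qBinom, show n + j - a + (b - j) = m by omega,
        show n + j - a + (a - j) = n by omega]
      ring
  · rfl

end QT
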